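/- The midpoint mechanism 2^n-approximates the Nash welfare: for every profile x ∈ [0,1]^n and every y ∈ [0,1], Nash(y, x) ≤ 2^n·Nash(Mid(x), x). -/

import Mathlib

open Set

noncomputable section

/-- Utility of an agent at location `z` when the facility is at `y`. -/
def util (y z : ℝ) : ℝ := 1 - |y - z|

/-- Nash welfare: product of agents' utilities. -/
def nash {n : ℕ} (y : ℝ) (x : Fin n → ℝ) : ℝ := ∏ i, util y (x i)

/-- `y` is a Nash optimum for the profile `x`. -/
def isNashOpt {n : ℕ} (x : Fin n → ℝ) (y : ℝ) : Prop :=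
  y ∈ Set.Icc (0 : ℝ) 1 ∧ ∀ z ∈ Set.Icc (0 : ℝ) 1, nash z x ≤ nash y x

/-- The midpoint mechanism. -/
def mid {n : ℕ} (x : Fin n → ℝ) : ℝ := ((⨅ i, x i) + (⨆ i, x i)) / 2

/-- Every agent is within distance `1 / 2` of the midpoint of the profile. -/
theorem half_le_util_mid {n : ℕ} (x : Fin n → ℝ)
    (hx : ∀ i, x i ∈ Set.Icc (0 : ℝ) 1) (i : Fin n) : 1 / 2 ≤ util (mid x) (x i) := by
  have : Nonempty (Fin n) := ⟨i⟩
  have hinf : ⨅ j, x j ≤ x i := ciInf_le (Set.finite_range x).bddBelow i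
  have hsup : x i ≤ ⨆ j, x j := le_ciSup (Set.finite_range x).bddAbove i
  have hinf_nonneg : 0 ≤ ⨅ j, x j := le_ciInf fun j => (hx j).1
  have hsup_le_one : ⨆ j, x j ≤ 1 := ciSup_le fun j => (hx j).2
  have habs : |mid x - x i| ≤ 1 / 2 := by
    unfold mid
    rw [abs_le]
    constructor <;> linarith
  unfold util
  linarith

/-- On the unit interval, utilities are nonnegative. -/
theorem util_nonneg {y z : ℝ} (hy : y ∈ Set.Icc (0 : ℝ) 1) (hz : z ∈ Set.Icc (0 : ℝ) 1) :
    0 ≤ util y z := by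
  have habs : |y - z| ≤ 1 := by
    rw [abs_le]
    constructor <;> linarith [hy.1, hy.2, hz.1, hz.2]
  unfold util
  linarith

theorem util_le_one (y z : ℝ) : util y z ≤ 1 :=
  sub_le_self 1 (abs_nonneg (y - z))

theorem mid_nash_upper_bound (n : ℕ) (x : Fin n → ℝ)
    (hx : ∀ i, x i ∈ Set.Icc (0 : ℝ) 1) :
    ∀ y ∈ Set.Icc (0 : ℝ) 1, nash y x ≤ 2 ^ n * nash (mid x) x := by
  intro y hy
  calc nash y x ≤ ∏ i, 2 * util (mid x) (x i) :=
        Finset.prod_le_prod (fun i _ => util_nonneg hy (hx i)) fun i _ => by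
          linarith [util_le_one y (x i), half_le_util_mid x hx i]
    _ = 2 ^ n * nash (mid x) x := by simp [nash, Finset.prod_mul_distrib]
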